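/- Let 1 < p < ∞, let W be a matrix A_p weight on ℝ^d with reducing operators V_I, let I ∈ 𝒟, let λ₂ > 1, and let 𝒢̃(I) be the collection of maximal dyadic subcubes J of I with ‖V_J^{−1} V_I‖^{p'} > λ₂. Then ∑_{J ∈ 𝒢̃(I)} |J| ≤ (C₂ ‖W‖_{A_p}^{p'/p} / λ₂) |I|, where C₂ depends only on n, d, p and p' = p/(p−1). -/

import Mathlib

open MeasureTheory ENNReal
open scoped ComplexOrder

noncomputable section

/-! ## Basic linear-algebra notation -/

/-- The operator norm of an `n × n` complex matrix, viewed as an operator on the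
Euclidean space `ℂⁿ`. -/
def matNorm {n : ℕ} (M : Matrix (Fin n) (Fin n) ℂ) : ℝ :=
  ‖Matrix.toEuclideanCLM (𝕜 := ℂ) (n := Fin n) M‖

/-- A matrix applied to a vector of `ℂⁿ` (with its Euclidean norm). -/
def mApp {n : ℕ} (M : Matrix (Fin n) (Fin n) ℂ) (v : EuclideanSpace ℂ (Fin n)) :
    EuclideanSpace ℂ (Fin n) :=
  Matrix.toEuclideanCLM (𝕜 := ℂ) (n := Fin n) M v


/-- Entrywise measurability of a matrix-valued function. -/
def MatMeasurable {d n : ℕ} (W : (Fin d → ℝ) → Matrix (Fin n) (Fin n) ℂ) : Prop :=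
  ∀ i j, Measurable fun x => W x i j

/-! ## Dyadic cubes and Haar functions -/

/-- A dyadic cube in `ℝ^d`, with side length `2^k` and lower-left corner `(m i * 2^k)_i`. -/
structure DCube (d : ℕ) where
  k : ℤ
  m : Fin d → ℤ

namespace DCube

variable {d : ℕ}

/-- The (half-open) cube in `ℝ^d` determined by a dyadic cube. -/
def set (I : DCube d) : Set (Fin d → ℝ) :=
  {x | ∀ i, (I.m i : ℝ) * 2 ^ I.k ≤ x i ∧ x i < ((I.m i : ℝ) + 1) * 2 ^ I.k}

/-- The volume `|I| = (2^k)^d` of a dyadic cube. -/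
def vol (I : DCube d) : ℝ := ((2 : ℝ) ^ I.k) ^ d

/-- The lower-left corner of a dyadic cube. -/
def corner (I : DCube d) : Fin d → ℝ := fun i => (I.m i : ℝ) * 2 ^ I.k

/-- The side length of a dyadic cube. -/
def side (I : DCube d) : ℝ := (2 : ℝ) ^ I.k

end DCube

/-- One-dimensional Haar functions on the dyadic interval `[m·2^k, (m+1)·2^k)`:
`haar1D true` is the non-cancellative `|I|^{-1/2} χ_I`, while `haar1D false` is
`|I|^{-1/2} (χ_{I_ℓ} - χ_{I_r})`. -/
def haar1D (ε : Bool) (k mm : ℤ) (t : ℝ) : ℝ :=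
  if ε then
    Set.indicator {s : ℝ | (mm : ℝ) * 2 ^ k ≤ s ∧ s < ((mm : ℝ) + 1) * 2 ^ k}
      (fun _ => ((2 : ℝ) ^ k) ^ (-(1 / 2 : ℝ))) t
  else
    Set.indicator {s : ℝ | (mm : ℝ) * 2 ^ k ≤ s ∧ s < (mm : ℝ) * 2 ^ k + 2 ^ (k - 1)}
      (fun _ => ((2 : ℝ) ^ k) ^ (-(1 / 2 : ℝ))) t -
    Set.indicator {s : ℝ | (mm : ℝ) * 2 ^ k + 2 ^ (k - 1) ≤ s ∧ s < ((mm : ℝ) + 1) * 2 ^ k}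
      (fun _ => ((2 : ℝ) ^ k) ^ (-(1 / 2 : ℝ))) t

/-- The signature set `𝒮 = {0,1}^d \ {(1,…,1)}` indexing the cancellative Haar functions. -/
def Sfin (d : ℕ) : Finset (Fin d → Bool) := Finset.univ.erase (fun _ => true)

/-- The Haar function `h_I^ε = ∏ i, h_{I_i}^{ε_i}` associated to a dyadic cube `I ⊂ ℝ^d`
and a signature `ε ∈ {0,1}^d`. -/
def haarFn {d : ℕ} (I : DCube d) (ε : Fin d → Bool) (x : Fin d → ℝ) : ℝ :=
  ∏ i, haar1D (ε i) I.k (I.m i) (x i)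

/-- The (vector of) Haar coefficients `f_I^ε = ∫ f h_I^ε` of a `ℂⁿ`-valued function. -/
def haarCoef {d n : ℕ} (f : (Fin d → ℝ) → EuclideanSpace ℂ (Fin n)) (I : DCube d)
    (ε : Fin d → Bool) : EuclideanSpace ℂ (Fin n) :=
  ∫ x, haarFn I ε x • f x

/-! ## Matrix `A_p` weights and reducing operators -/

/-- The (closed, axis-parallel) cube with corner `c` and side length `r`. -/
def cubeSet {d : ℕ} (c : Fin d → ℝ) (r : ℝ) : Set (Fin d → ℝ) :=
  {x | ∀ i, c i ≤ x i ∧ x i ≤ c i + r}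

/-- The matrix `A_p` characteristic `‖W‖_{A_p}` of a matrix weight `W`, expressed in terms of
`W1p = W^{1/p}` (so that `W^{-1/p} = (W1p)⁻¹`):
`sup_I (1/|I|) ∫_I ((1/|I|) ∫_I ‖W^{1/p}(x) W^{-1/p}(t)‖^{p'} dt)^{p/p'} dx`,
the supremum being over all cubes `I ⊂ ℝ^d`.  Here `p' = p/(p-1)` and `p/p' = p - 1`. -/
def apNorm {d n : ℕ} (p : ℝ) (W1p : (Fin d → ℝ) → Matrix (Fin n) (Fin n) ℂ) : ℝ≥0∞ :=
  ⨆ (c : Fin d → ℝ) (r : ℝ) (_ : 0 < r),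
    (ENNReal.ofReal (r ^ d))⁻¹ *
      ∫⁻ x in cubeSet c r,
        ((ENNReal.ofReal (r ^ d))⁻¹ *
            ∫⁻ t in cubeSet c r,
              ENNReal.ofReal (matNorm (W1p x * (W1p t)⁻¹)) ^ (p / (p - 1))) ^ (p - 1)

/-- The `L^q` average `(|I|^{-1} ∫_I ‖A(x) e‖^q dx)^{1/q}` over a dyadic cube. -/
def redAvgD {d n : ℕ} (q : ℝ) (A : (Fin d → ℝ) → Matrix (Fin n) (Fin n) ℂ) (I : DCube d)
    (e : EuclideanSpace ℂ (Fin n)) : ℝ≥0∞ :=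
  ((ENNReal.ofReal I.vol)⁻¹ * ∫⁻ x in I.set, ENNReal.ofReal ‖mApp (A x) e‖ ^ q) ^ (1 / q)

/-- `V` is a family of reducing operators for the weight `W = (W1p)^p` (indexed by dyadic
cubes), with comparability constants `c₁, c₂`:  each `V I` is positive definite and
`|V_I e| ≈ (|I|^{-1} ∫_I |W^{1/p}(x) e|^p dx)^{1/p}`. -/
def IsReducing {d n : ℕ} (p c₁ c₂ : ℝ) (W1p : (Fin d → ℝ) → Matrix (Fin n) (Fin n) ℂ)
    (V : DCube d → Matrix (Fin n) (Fin n) ℂ) : Prop :=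
  ∀ I : DCube d, (V I).PosDef ∧ ∀ e : EuclideanSpace ℂ (Fin n),
    ENNReal.ofReal c₁ * redAvgD p W1p I e ≤ ENNReal.ofReal ‖mApp (V I) e‖ ∧
    ENNReal.ofReal ‖mApp (V I) e‖ ≤ ENNReal.ofReal c₂ * redAvgD p W1p I e

/-- `V'` is a family of dual reducing operators for the weight `W = (W1p)^p`:
`|V_I' e| ≈ (|I|^{-1} ∫_I |W^{-1/p}(x) e|^{p'} dx)^{1/p'}` with `p' = p/(p-1)`. -/
def IsDualReducing {d n : ℕ} (p c₁ c₂ : ℝ) (W1p : (Fin d → ℝ) → Matrix (Fin n) (Fin n) ℂ)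
    (V' : DCube d → Matrix (Fin n) (Fin n) ℂ) : Prop :=
  ∀ I : DCube d, (V' I).PosDef ∧ ∀ e : EuclideanSpace ℂ (Fin n),
    ENNReal.ofReal c₁ * redAvgD (p / (p - 1)) (fun x => (W1p x)⁻¹) I e ≤
        ENNReal.ofReal ‖mApp (V' I) e‖ ∧
    ENNReal.ofReal ‖mApp (V' I) e‖ ≤
        ENNReal.ofReal c₂ * redAvgD (p / (p - 1)) (fun x => (W1p x)⁻¹) I e

/-- The `L^p(W)` norm `(∫ |W^{1/p}(x) f(x)|^p dx)^{1/p}` (as a value in `[0,∞]`). -/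
def wNorm {d n : ℕ} (p : ℝ) (W1p : (Fin d → ℝ) → Matrix (Fin n) (Fin n) ℂ)
    (f : (Fin d → ℝ) → EuclideanSpace ℂ (Fin n)) : ℝ≥0∞ :=
  (∫⁻ x, ENNReal.ofReal ‖mApp (W1p x) (f x)‖ ^ p) ^ (1 / p)

/-- The square-function expression
`∑_{I ∈ 𝒟} ∑_{ε ∈ 𝒮} |A_I f_I^ε|² |I|^{-1} χ_I(x)` for a family of matrices `A_I`. -/
def sqFn {d n : ℕ} (A : DCube d → Matrix (Fin n) (Fin n) ℂ)
    (f : (Fin d → ℝ) → EuclideanSpace ℂ (Fin n)) (x : Fin d → ℝ) : ℝ≥0∞ :=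
  ∑' I : DCube d, ∑ ε ∈ Sfin d,
    Set.indicator I.set
      (fun _ => ENNReal.ofReal (‖mApp (A I) (haarCoef f I ε)‖ ^ 2) / ENNReal.ofReal I.vol) x

/-! ## Stopping times -/

/-- A stopping time assigns to each dyadic cube `I` a collection `𝒥 I` of pairwise disjoint
dyadic subcubes of `I`. -/
def IsStopping {d : ℕ} (𝒥 : DCube d → Set (DCube d)) : Prop :=
  ∀ I : DCube d, (∀ J ∈ 𝒥 I, J.set ⊆ I.set) ∧
    (𝒥 I).Pairwise fun J K => Disjoint J.set K.set

/-- `ℱ(I)`: the dyadic subcubes of `I` not contained in any stopping cube `J ∈ 𝒥(I)`. -/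
def Fcol {d : ℕ} (𝒥 : DCube d → Set (DCube d)) (I : DCube d) : Set (DCube d) :=
  {J | J.set ⊆ I.set ∧ ∀ K ∈ 𝒥 I, ¬J.set ⊆ K.set}

/-- A stopping time is admissible if `I ∈ ℱ(I)` for every `I`. -/
def Admissible {d : ℕ} (𝒥 : DCube d → Set (DCube d)) : Prop :=
  ∀ I : DCube d, I ∈ Fcol 𝒥 I

/-- The iterated stopping collections: `𝒥^0(I) = {I}` and
`𝒥^{j+1}(I) = ⋃_{J ∈ 𝒥^j(I)} 𝒥(J)`. -/
def JIter {d : ℕ} (𝒥 : DCube d → Set (DCube d)) : ℕ → DCube d → Set (DCube d)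
  | 0, I => {I}
  | j + 1, I => ⋃ J ∈ JIter 𝒥 j I, 𝒥 J

/-- A stopping time is decaying with constant `c` if
`∑_{J ∈ 𝒥(I)} |J| ≤ c |I|` for every `I`. -/
def Decaying {d : ℕ} (c : ℝ) (𝒥 : DCube d → Set (DCube d)) : Prop :=
  ∀ I : DCube d,
    ∑' J : 𝒥 I, ENNReal.ofReal (J : DCube d).vol ≤ ENNReal.ofReal c * ENNReal.ofReal I.vol

/-- `ℱ^j = ℱ^j(I₀) = ⋃_{J ∈ 𝒥^{j-1}(I₀)} ℱ(J)` (intended for `j ≥ 1`). -/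
def Fj {d : ℕ} (𝒥 : DCube d → Set (DCube d)) (I₀ : DCube d) (j : ℕ) : Set (DCube d) :=
  ⋃ J ∈ JIter 𝒥 (j - 1) I₀, Fcol 𝒥 J

/-- The Haar projection `Δ_j f = ∑_{I ∈ ℱ^j} ∑_{ε ∈ 𝒮} f_I^ε h_I^ε`. -/
def deltaHaar {d n : ℕ} (𝒥 : DCube d → Set (DCube d)) (I₀ : DCube d) (j : ℕ)
    (f : (Fin d → ℝ) → EuclideanSpace ℂ (Fin n)) (x : Fin d → ℝ) :
    EuclideanSpace ℂ (Fin n) :=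
  ∑' I : Fj 𝒥 I₀ j, ∑ ε ∈ Sfin d, haarFn (I : DCube d) ε x • haarCoef f (I : DCube d) ε

/-! ## Constant Haar multipliers -/

/-- `∑_{I ∈ S} ∑_{ε ∈ 𝒮} V_I^{-1} f_I^ε h_I^ε(x)`. -/
def projInv {d n : ℕ} (V : DCube d → Matrix (Fin n) (Fin n) ℂ) (S : Set (DCube d))
    (f : (Fin d → ℝ) → EuclideanSpace ℂ (Fin n)) (x : Fin d → ℝ) :
    EuclideanSpace ℂ (Fin n) :=
  ∑' I : S, ∑ ε ∈ Sfin d,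
    haarFn (I : DCube d) ε x • mApp ((V (I : DCube d))⁻¹) (haarCoef f (I : DCube d) ε)

/-- A function has finite Haar expansion if it is a finite sum of Haar functions. -/
def FiniteHaar {d n : ℕ} (f : (Fin d → ℝ) → EuclideanSpace ℂ (Fin n)) : Prop :=
  ∃ F : Finset (DCube d × (Fin d → Bool)),
    ∀ x, f x = ∑ q ∈ F, haarFn q.1 q.2 x • haarCoef f q.1 q.2

/-! ## The weighted stopping time -/

/-- The stopping condition `‖V_J V_I^{-1}‖^p > λ₁` or `‖V_J^{-1} V_I‖^{p'} > λ₂`. -/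
def stopBad {d n : ℕ} (p l₁ l₂ : ℝ) (V : DCube d → Matrix (Fin n) (Fin n) ℂ)
    (J I : DCube d) : Prop :=
  l₁ < matNorm (V J * (V I)⁻¹) ^ p ∨ l₂ < matNorm ((V J)⁻¹ * V I) ^ (p / (p - 1))

/-- The stopping time `𝒥(I)` = maximal dyadic subcubes `J ⊆ I` satisfying `stopBad`. -/
def stopST {d n : ℕ} (p l₁ l₂ : ℝ) (V : DCube d → Matrix (Fin n) (Fin n) ℂ)
    (I : DCube d) : Set (DCube d) :=
  {J | J.set ⊆ I.set ∧ stopBad p l₁ l₂ V J I ∧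
    ∀ K : DCube d, K.set ⊆ I.set → stopBad p l₁ l₂ V K I → J.set ⊆ K.set → K = J}


section Matrices

variable {n : ℕ}

lemma mApp_mul (A B : Matrix (Fin n) (Fin n) ℂ) (v : EuclideanSpace ℂ (Fin n)) :
    mApp (A * B) v = mApp A (mApp B v) := by
  simp [mApp]

lemma mApp_add (A : Matrix (Fin n) (Fin n) ℂ) (u v : EuclideanSpace ℂ (Fin n)) :
    mApp A (u + v) = mApp A u + mApp A v :=
  map_add _ u v

lemma mApp_smul (A : Matrix (Fin n) (Fin n) ℂ) (c : ℂ) (v : EuclideanSpace ℂ (Fin n)) :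
    mApp A (c • v) = c • mApp A v :=
  map_smul _ c v

lemma mApp_mul_inv {A : Matrix (Fin n) (Fin n) ℂ} (hA : A.PosDef)
    (v : EuclideanSpace ℂ (Fin n)) : mApp A (mApp A⁻¹ v) = v := by
  rw [← mApp_mul, Matrix.mul_nonsing_inv _ ((Matrix.isUnit_iff_isUnit_det _).1 hA.isUnit)]
  simp [mApp]

lemma inner_mApp_left {A : Matrix (Fin n) (Fin n) ℂ} (hA : A.IsHermitian)
    (u v : EuclideanSpace ℂ (Fin n)) :
    inner ℂ (mApp A u) v = inner ℂ u (mApp A v) := by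
  have h : star (Matrix.toEuclideanCLM (𝕜 := ℂ) (n := Fin n) A) =
      Matrix.toEuclideanCLM (𝕜 := ℂ) (n := Fin n) A := by
    rw [← map_star]
    exact congrArg _ hA
  unfold mApp
  conv_lhs => rw [← h]
  exact ContinuousLinearMap.adjoint_inner_left _ _ _

lemma norm_mApp_le (A : Matrix (Fin n) (Fin n) ℂ) (v : EuclideanSpace ℂ (Fin n)) :
    ‖mApp A v‖ ≤ matNorm A * ‖v‖ :=
  ContinuousLinearMap.le_opNorm _ _

lemma matNorm_nonneg (A : Matrix (Fin n) (Fin n) ℂ) : 0 ≤ matNorm A :=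
  norm_nonneg _

lemma matNorm_mul_comm {A B : Matrix (Fin n) (Fin n) ℂ} (hA : A.IsHermitian)
    (hB : B.IsHermitian) : matNorm (A * B) = matNorm (B * A) := by
  have h : star (A * B) = B * A := by
    rw [star_mul]
    exact congrArg₂ _ hB hA
  rw [← h, matNorm, matNorm, map_star]
  exact (LinearIsometryEquiv.norm_map ContinuousLinearMap.adjoint _).symm

lemma matNorm_le_sum (A : Matrix (Fin n) (Fin n) ℂ) :
    matNorm A ≤ ∑ j, ‖mApp A (EuclideanSpace.single j 1)‖ := by
  refine ContinuousLinearMap.opNorm_le_bound _ (by positivity) fun v => ?_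
  change ‖mApp A v‖ ≤ _
  have hv : v = ∑ j, v j • EuclideanSpace.single j (1 : ℂ) := by
    simpa using ((EuclideanSpace.basisFun (Fin n) ℂ).sum_repr v).symm
  have h : mApp A v = ∑ j, v j • mApp A (EuclideanSpace.single j 1) := by
    conv_lhs => rw [hv]
    simp [mApp, map_sum]
  rw [h, Finset.sum_mul]
  refine (norm_sum_le _ _).trans (Finset.sum_le_sum fun j _ => ?_)
  rw [norm_smul, mul_comm]
  exact mul_le_mul_of_nonneg_left (PiLp.norm_apply_le v j) (norm_nonneg _)

end Matrices

section Measurability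

variable {d n : ℕ}

lemma MatMeasurable.inv {W : (Fin d → ℝ) → Matrix (Fin n) (Fin n) ℂ} (hW : MatMeasurable W) :
    MatMeasurable fun x => (W x)⁻¹ := by
  have hW' : Measurable fun x i j => W x i j :=
    measurable_pi_lambda _ fun i => measurable_pi_lambda _ fun j => hW i j
  have hdet : Continuous fun M : Fin n → Fin n → ℂ => Matrix.det (Matrix.of M) :=
    Continuous.matrix_det continuous_id
  intro i j
  have hadj : Continuous fun M : Fin n → Fin n → ℂ => Matrix.adjugate (Matrix.of M) i j :=
    (Continuous.matrix_adjugate continuous_id).matrix_elem i j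
  have h : (fun x => (W x)⁻¹ i j) = fun x => (W x).det⁻¹ * (W x).adjugate i j := by
    ext x
    simp [Matrix.inv_def]
  rw [h]
  exact (hdet.measurable.comp hW').inv.mul (hadj.measurable.comp hW')

lemma MatMeasurable.norm_mApp {W : (Fin d → ℝ) → Matrix (Fin n) (Fin n) ℂ}
    (hW : MatMeasurable W) (v : EuclideanSpace ℂ (Fin n)) :
    Measurable fun x => ‖mApp (W x) v‖ := by
  have h : (fun x => ‖mApp (W x) v‖) = fun x => √(∑ i, ‖∑ j, W x i j * v j‖ ^ 2) := by
    ext x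
    rw [EuclideanSpace.norm_eq]
    rfl
  rw [h]
  exact (Finset.measurable_fun_sum _ fun i _ =>
    (Finset.measurable_fun_sum _ fun j _ => (hW i j).mul_const _).norm.pow_const _).sqrt

end Measurability

namespace DCube

variable {d : ℕ}

instance : Countable (DCube d) := by
  refine Function.Injective.countable (f := fun I : DCube d => (I.k, I.m)) ?_
  rintro ⟨k, m⟩ ⟨k', m'⟩ h
  simp_all

lemma set_eq_pi (I : DCube d) :
    I.set = Set.univ.pi fun i =>
      Set.Ico ((I.m i : ℝ) * 2 ^ I.k) (((I.m i : ℝ) + 1) * 2 ^ I.k) := by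
  ext x
  simp [DCube.set]

lemma measurableSet_set (I : DCube d) : MeasurableSet I.set := by
  rw [set_eq_pi]
  exact MeasurableSet.univ_pi fun _ => measurableSet_Ico

lemma vol_pos (I : DCube d) : 0 < I.vol := by
  unfold vol
  positivity

lemma volume_set (I : DCube d) : volume I.set = ENNReal.ofReal I.vol := by
  rw [set_eq_pi, Real.volume_pi_Ico]
  have h (i : Fin d) : ((I.m i : ℝ) + 1) * 2 ^ I.k - (I.m i : ℝ) * 2 ^ I.k = 2 ^ I.k := by ring
  simp [h, vol, ENNReal.ofReal_pow (show (0 : ℝ) ≤ 2 ^ I.k by positivity)]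

lemma set_subset_cubeSet (I : DCube d) : I.set ⊆ cubeSet I.corner I.side := by
  intro x hx i
  have := hx i
  simp only [corner, side]
  constructor <;> linarith

lemma set_subset_set_of_le {J K : DCube d} (hk : J.k ≤ K.k)
    (h : ¬Disjoint J.set K.set) : J.set ⊆ K.set := by
  obtain ⟨x, hxJ, hxK⟩ := Set.not_disjoint_iff.1 h
  obtain ⟨a, ha⟩ := Int.eq_ofNat_of_zero_le (sub_nonneg.2 hk)
  have hpow : (2 : ℝ) ^ K.k = ((2 ^ a : ℤ) : ℝ) * 2 ^ J.k := by
    rw [show K.k = a + J.k by lia, zpow_add₀ two_ne_zero]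
    simp
  have hpos : (0 : ℝ) < 2 ^ J.k := by positivity
  intro y hy i
  have h1 : K.m i * 2 ^ a < J.m i + 1 := by
    have := (hxK i).1.trans_lt (hxJ i).2
    rw [hpow, ← mul_assoc] at this
    exact_mod_cast lt_of_mul_lt_mul_right this hpos.le
  have h2 : J.m i < (K.m i + 1) * 2 ^ a := by
    have := (hxJ i).1.trans_lt (hxK i).2
    rw [hpow, ← mul_assoc] at this
    exact_mod_cast lt_of_mul_lt_mul_right this hpos.le
  have h1' : ((K.m i * 2 ^ a : ℤ) : ℝ) ≤ (J.m i : ℝ) := by exact_mod_cast Int.lt_add_one_iff.1 h1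
  have h2' : (J.m i : ℝ) + 1 ≤ (((K.m i + 1) * 2 ^ a : ℤ) : ℝ) := by exact_mod_cast h2
  rw [hpow, ← mul_assoc, ← mul_assoc]
  push_cast at h1' h2' ⊢
  exact ⟨(mul_le_mul_of_nonneg_right h1' hpos.le).trans (hy i).1,
    (hy i).2.trans_le (mul_le_mul_of_nonneg_right h2' hpos.le)⟩

lemma set_subset_or_subset {J K : DCube d} (h : ¬Disjoint J.set K.set) :
    J.set ⊆ K.set ∨ K.set ⊆ J.set := by
  rcases le_total J.k K.k with hk | hk
  · exact Or.inl (set_subset_set_of_le hk h)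
  · exact Or.inr (set_subset_set_of_le hk (fun h' => h h'.symm))

/-- Maximal dyadic cubes with a given property are pairwise disjoint. -/
lemma pairwise_disjoint_of_maximal {P : DCube d → Prop} {S : Set (DCube d)}
    (hS : ∀ J ∈ S, P J ∧ ∀ K, P K → J.set ⊆ K.set → K = J) :
    Pairwise fun J K : S => Disjoint (J : DCube d).set (K : DCube d).set := by
  rintro ⟨J, hJ⟩ ⟨K, hK⟩ hne
  by_contra h
  rcases set_subset_or_subset h with h' | h'
  · exact hne (Subtype.ext ((hS J hJ).2 K (hS K hK).1 h').symm)
  · exact hne (Subtype.ext ((hS K hK).2 J (hS J hJ).1 h'))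

end DCube

/-- A vector form of the Hahn–Banach theorem: a seminorm on `ℂⁿ` is attained at a given vector by
pairing with a suitable vector of the dual unit ball. -/
lemma Seminorm.exists_inner_eq {E : Type*} [NormedAddCommGroup E] [InnerProductSpace ℂ E]
    [FiniteDimensional ℂ E] (N : Seminorm ℂ E) (u : E) :
    ∃ φ : E, inner ℂ φ u = (N u : ℂ) ∧ ∀ v, ‖inner ℂ φ v‖ ≤ N v := by
  have : CompleteSpace E := FiniteDimensional.complete ℂ E
  suffices h : ∃ g : Module.Dual ℂ E, g u = (N u : ℂ) ∧ ∀ v, ‖g v‖ ≤ N v by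
    obtain ⟨g, hgu, hg⟩ := h
    refine ⟨(InnerProductSpace.toDual ℂ E).symm (LinearMap.toContinuousLinearMap g), ?_, ?_⟩
    · simpa using hgu
    · simpa using hg
  rcases eq_or_ne u 0 with rfl | hu
  · exact ⟨(0 : E →ₗ[ℂ] ℂ), by simp, fun v => by simp⟩
  let f : E →ₗ.[ℂ] ℂ := LinearPMap.mkSpanSingleton u (N u : ℂ) hu
  have hf : ∀ x : f.domain, ‖f x‖ ≤ N x := by
    rintro ⟨x, hx⟩
    obtain ⟨c, rfl⟩ := Submodule.mem_span_singleton.1 hx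
    rw [LinearPMap.mkSpanSingleton'_apply]
    simp [map_smul_eq_mul, abs_of_nonneg]
  obtain ⟨g, hgf, hg⟩ := Module.Dual.exists_extension_of_le_seminorm f.domain f.toFun hf
  refine ⟨g, ?_, hg⟩
  rw [hgf ⟨u, Submodule.mem_span_singleton_self u⟩]
  exact LinearPMap.mkSpanSingleton_apply ℂ ℂ hu _

section Averages

variable {d n : ℕ} {A : (Fin d → ℝ) → Matrix (Fin n) (Fin n) ℂ} {q : ℝ}

lemma ofReal_vol_ne_zero (I : DCube d) : ENNReal.ofReal I.vol ≠ 0 := by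
  simpa using I.vol_pos

lemma ofReal_vol_mul_redAvgD_rpow (hq : 0 < q) (I : DCube d) (u : EuclideanSpace ℂ (Fin n)) :
    ENNReal.ofReal I.vol * redAvgD q A I u ^ q =
      ∫⁻ x in I.set, ENNReal.ofReal ‖mApp (A x) u‖ ^ q := by
  rw [redAvgD, one_div, ENNReal.rpow_inv_rpow hq.ne', ← mul_assoc,
    ENNReal.mul_inv_cancel (ofReal_vol_ne_zero I) ENNReal.ofReal_ne_top, one_mul]

lemma redAvgD_eq_mul (hq : 0 < q) (I : DCube d) (u : EuclideanSpace ℂ (Fin n)) :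
    redAvgD q A I u = (ENNReal.ofReal I.vol)⁻¹ ^ (1 / q) *
      (∫⁻ x in I.set, ENNReal.ofReal ‖mApp (A x) u‖ ^ q) ^ (1 / q) := by
  rw [redAvgD, ENNReal.mul_rpow_of_nonneg _ _ (by positivity)]

lemma redAvgD_add_le (hA : MatMeasurable A) (hq : 1 ≤ q) (I : DCube d)
    (u v : EuclideanSpace ℂ (Fin n)) :
    redAvgD q A I (u + v) ≤ redAvgD q A I u + redAvgD q A I v := by
  have hq0 : 0 < q := zero_lt_one.trans_le hq
  simp only [redAvgD_eq_mul hq0, ← mul_add]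
  refine mul_le_mul_right (le_trans ?_ (ENNReal.lintegral_Lp_add_le
    (hA.norm_mApp u).ennreal_ofReal.aemeasurable (hA.norm_mApp v).ennreal_ofReal.aemeasurable hq)) _
  gcongr with x
  rw [mApp_add, Pi.add_apply, ← ENNReal.ofReal_add (norm_nonneg _) (norm_nonneg _)]
  exact ENNReal.ofReal_le_ofReal (norm_add_le _ _)

lemma redAvgD_smul (hq : 0 < q) (I : DCube d) (c : ℂ) (u : EuclideanSpace ℂ (Fin n)) :
    redAvgD q A I (c • u) = ENNReal.ofReal ‖c‖ * redAvgD q A I u := by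
  have h (x) : ENNReal.ofReal ‖mApp (A x) (c • u)‖ ^ q =
      ENNReal.ofReal ‖c‖ ^ q * ENNReal.ofReal ‖mApp (A x) u‖ ^ q := by
    rw [mApp_smul, norm_smul, ENNReal.ofReal_mul (norm_nonneg _),
      ENNReal.mul_rpow_of_nonneg _ _ hq.le]
  simp only [redAvgD, h]
  rw [lintegral_const_mul' _ _ (by simp [hq.le]), mul_left_comm,
    ENNReal.mul_rpow_of_nonneg _ _ (by positivity), one_div, ENNReal.rpow_rpow_inv hq.ne']

end Averages

section Weights

variable {d n : ℕ} {p q c₁ c₂ : ℝ} {W : (Fin d → ℝ) → Matrix (Fin n) (Fin n) ℂ}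
  {V : DCube d → Matrix (Fin n) (Fin n) ℂ}

/-- The pairing of the averages of `W^{1/p}` and `W^{-1/p}` controls the inner product. -/
lemma ofReal_norm_inner_le_redAvgD_mul (hpq : p.HolderConjugate q) (hW : MatMeasurable W)
    (hpos : ∀ᵐ x, (W x).PosDef) (J : DCube d) (u g : EuclideanSpace ℂ (Fin n)) :
    ENNReal.ofReal ‖inner ℂ u g‖ ≤
      redAvgD q (fun x => (W x)⁻¹) J u * redAvgD p W J g := by
  have hv := ofReal_vol_ne_zero J
  have hp := hpq.pos
  have hq := hpq.symm.pos
  have hle : ENNReal.ofReal ‖inner ℂ u g‖ * ENNReal.ofReal J.vol ≤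
      ∫⁻ x in J.set, ENNReal.ofReal ‖mApp (W x)⁻¹ u‖ * ENNReal.ofReal ‖mApp (W x) g‖ := by
    rw [← J.volume_set, ← setLIntegral_const]
    refine lintegral_mono_ae (ae_restrict_of_ae ?_)
    filter_upwards [hpos] with x hx
    rw [← ENNReal.ofReal_mul (norm_nonneg _)]
    refine ENNReal.ofReal_le_ofReal ?_
    rw [← mApp_mul_inv hx u, inner_mApp_left hx.isHermitian, mApp_mul_inv hx]
    exact norm_inner_le_norm _ _
  have hholder := ENNReal.lintegral_mul_le_Lp_mul_Lq (volume.restrict J.set) hpq.symm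
    (hW.inv.norm_mApp u).ennreal_ofReal.aemeasurable (hW.norm_mApp g).ennreal_ofReal.aemeasurable
  have hvol : (ENNReal.ofReal J.vol)⁻¹ ^ (1 / q) * (ENNReal.ofReal J.vol)⁻¹ ^ (1 / p) =
      (ENNReal.ofReal J.vol)⁻¹ := by
    rw [← ENNReal.rpow_add_of_nonneg _ _ (by positivity) (by positivity), one_div, one_div,
      hpq.symm.inv_add_inv_eq_one, ENNReal.rpow_one]
  rw [redAvgD_eq_mul hq, redAvgD_eq_mul hp, mul_mul_mul_comm, hvol]
  calc ENNReal.ofReal ‖inner ℂ u g‖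
      = (ENNReal.ofReal J.vol)⁻¹ * (ENNReal.ofReal ‖inner ℂ u g‖ * ENNReal.ofReal J.vol) := by
        rw [mul_left_comm, ENNReal.inv_mul_cancel hv ENNReal.ofReal_ne_top, mul_one]
    _ ≤ _ := mul_le_mul_right (hle.trans hholder) _

lemma IsReducing.ofReal_norm_inv_le_redAvgD (hpq : p.HolderConjugate q) (hW : MatMeasurable W)
    (hpos : ∀ᵐ x, (W x).PosDef) (hV : IsReducing p c₁ c₂ W V) (J : DCube d)
    (u : EuclideanSpace ℂ (Fin n)) :
    ENNReal.ofReal c₁ * ENNReal.ofReal ‖mApp (V J)⁻¹ u‖ ≤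
      redAvgD q (fun x => (W x)⁻¹) J u := by
  obtain ⟨hVpos, hVJ⟩ := hV J
  set w := mApp (V J)⁻¹ u
  have hinner : ENNReal.ofReal ‖inner ℂ u (mApp (V J)⁻¹ w)‖ =
      ENNReal.ofReal ‖w‖ * ENNReal.ofReal ‖w‖ := by
    rw [← inner_mApp_left hVpos.inv.isHermitian, inner_self_eq_norm_sq_to_K, norm_pow, sq,
      ENNReal.ofReal_mul (norm_nonneg _)]
    simp [w]
  have h1 := ofReal_norm_inner_le_redAvgD_mul hpq hW hpos J u (mApp (V J)⁻¹ w)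
  have h2 := (hVJ (mApp (V J)⁻¹ w)).1
  rw [mApp_mul_inv hVpos] at h2
  rcases eq_or_ne (ENNReal.ofReal ‖w‖) 0 with h0 | h0
  · simp [h0]
  refine (ENNReal.mul_le_mul_iff_left h0 ENNReal.ofReal_ne_top).1 ?_
  calc ENNReal.ofReal c₁ * ENNReal.ofReal ‖w‖ * ENNReal.ofReal ‖w‖
      ≤ ENNReal.ofReal c₁ * (redAvgD q (fun x => (W x)⁻¹) J u *
          redAvgD p W J (mApp (V J)⁻¹ w)) := by
        rw [mul_assoc, ← hinner]
        gcongr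
    _ = redAvgD q (fun x => (W x)⁻¹) J u *
          (ENNReal.ofReal c₁ * redAvgD p W J (mApp (V J)⁻¹ w)) := by ring
    _ ≤ _ := by gcongr

/-- The inner average `|I|⁻¹ ∫_I ‖W^{1/p}(x) W^{-1/p}(t)‖^q dt` of the `A_p` characteristic. -/
def innerAvg (q : ℝ) (W : (Fin d → ℝ) → Matrix (Fin n) (Fin n) ℂ) (I : DCube d)
    (x : Fin d → ℝ) : ℝ≥0∞ :=
  (ENNReal.ofReal I.vol)⁻¹ * ∫⁻ t in I.set, ENNReal.ofReal (matNorm (W x * (W t)⁻¹)) ^ q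

lemma lintegral_innerAvg_le_apNorm (hp : 1 < p) (I : DCube d) :
    (ENNReal.ofReal I.vol)⁻¹ * ∫⁻ x in I.set, innerAvg (p / (p - 1)) W I x ^ (p - 1) ≤
      apNorm p W := by
  have hside : 0 < I.side := by
    unfold DCube.side
    positivity
  refine le_trans ?_ (le_iSup_of_le I.corner (le_iSup_of_le I.side (le_iSup_of_le hside le_rfl)))
  have hp' : 0 ≤ p - 1 := by linarith
  have hsub := I.set_subset_cubeSet
  change _ * ∫⁻ x in I.set, (_ * ∫⁻ t in I.set, _) ^ (p - 1) ≤ _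
  gcongr
  all_goals exact le_rfl

lemma redAvgD_inv_mApp_le (hq : 0 < q) (hpos : ∀ᵐ x, (W x).PosDef) (I : DCube d)
    {x : Fin d → ℝ} (hx : (W x).PosDef) (v : EuclideanSpace ℂ (Fin n)) :
    redAvgD q (fun t => (W t)⁻¹) I (mApp (W x) v) ≤
      innerAvg q W I x ^ (1 / q) * ENNReal.ofReal ‖v‖ := by
  have h : (ENNReal.ofReal I.vol)⁻¹ *
        ∫⁻ t in I.set, ENNReal.ofReal ‖mApp (W t)⁻¹ (mApp (W x) v)‖ ^ q ≤
      innerAvg q W I x * ENNReal.ofReal ‖v‖ ^ q := by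
    rw [innerAvg, mul_assoc, ← lintegral_mul_const' _ _ (by simp [hq.le])]
    refine mul_le_mul_right (lintegral_mono_ae (ae_restrict_of_ae ?_)) _
    filter_upwards [hpos] with t ht
    rw [← ENNReal.mul_rpow_of_nonneg _ _ hq.le, ← ENNReal.ofReal_mul (matNorm_nonneg _),
      matNorm_mul_comm hx.isHermitian ht.inv.isHermitian, ← mApp_mul]
    exact ENNReal.rpow_le_rpow (ENNReal.ofReal_le_ofReal (norm_mApp_le _ _)) hq.le
  refine (ENNReal.rpow_le_rpow h (by positivity)).trans_eq ?_
  rw [ENNReal.mul_rpow_of_nonneg _ _ (by positivity), one_div, ENNReal.rpow_rpow_inv hq.ne']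

lemma exists_innerAvg_lt_top (hp : 1 < p) (hpos : ∀ᵐ x, (W x).PosDef)
    (hap : apNorm p W < ⊤) (I : DCube d) :
    ∃ x, (W x).PosDef ∧ innerAvg (p / (p - 1)) W I x < ⊤ := by
  by_contra! h
  refine hap.not_ge (le_trans ?_ (lintegral_innerAvg_le_apNorm hp I))
  have htop : ∫⁻ x in I.set, innerAvg (p / (p - 1)) W I x ^ (p - 1) = ⊤ := by
    refine top_le_iff.1 (le_trans ?_ (lintegral_mono_ae (f := fun _ => ⊤) (ae_restrict_of_ae ?_)))
    · simp [I.volume_set, I.vol_pos, ENNReal.top_mul]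
    · filter_upwards [hpos] with x hx
      rw [top_le_iff.1 (h x hx), ENNReal.top_rpow_of_pos (by linarith)]
  rw [htop, ENNReal.mul_top (ENNReal.inv_ne_zero.2 ENNReal.ofReal_ne_top)]

lemma redAvgD_inv_lt_top (hp : 1 < p) (hpos : ∀ᵐ x, (W x).PosDef) (hap : apNorm p W < ⊤)
    (I : DCube d) (u : EuclideanSpace ℂ (Fin n)) :
    redAvgD (p / (p - 1)) (fun t => (W t)⁻¹) I u < ⊤ := by
  have hq : 0 < p / (p - 1) := div_pos (by linarith) (by linarith)
  obtain ⟨x, hx, hfin⟩ := exists_innerAvg_lt_top hp hpos hap I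
  have h := redAvgD_inv_mApp_le hq hpos I hx (mApp (W x)⁻¹ u)
  rw [mApp_mul_inv hx] at h
  exact h.trans_lt (ENNReal.mul_lt_top
    (ENNReal.rpow_lt_top_of_nonneg (by positivity) hfin.ne) ENNReal.ofReal_lt_top)

/-- The dual average of a matrix `A_p` weight as a seminorm on `ℂⁿ`. -/
def dualSeminorm (hp : 1 < p) (hW : MatMeasurable W) (hpos : ∀ᵐ x, (W x).PosDef)
    (hap : apNorm p W < ⊤) (I : DCube d) : Seminorm ℂ (EuclideanSpace ℂ (Fin n)) :=
  Seminorm.of (fun u => (redAvgD (p / (p - 1)) (fun t => (W t)⁻¹) I u).toReal)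
    (fun u v => by
      have hfin := redAvgD_inv_lt_top hp hpos hap I
      rw [← ENNReal.toReal_add (hfin u).ne (hfin v).ne]
      refine ENNReal.toReal_mono (ENNReal.add_lt_top.2 ⟨hfin u, hfin v⟩).ne
        (redAvgD_add_le hW.inv ?_ I u v)
      rw [one_le_div (by linarith)]
      linarith)
    (fun c u => by
      rw [redAvgD_smul (div_pos (by linarith) (by linarith)),
        ENNReal.toReal_ofReal_mul _ _ (norm_nonneg _)])

lemma ofReal_dualSeminorm (hp : 1 < p) (hW : MatMeasurable W) (hpos : ∀ᵐ x, (W x).PosDef)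
    (hap : apNorm p W < ⊤) (I : DCube d) (u : EuclideanSpace ℂ (Fin n)) :
    ENNReal.ofReal (dualSeminorm hp hW hpos hap I u) =
      redAvgD (p / (p - 1)) (fun t => (W t)⁻¹) I u :=
  ENNReal.ofReal_toReal (redAvgD_inv_lt_top hp hpos hap I u).ne

/-- The `W`-average of a vector in the unit ball dual to the dual average is controlled by the
`A_p` characteristic. -/
lemma redAvgD_le_apNorm_rpow (hp : 1 < p) (hW : MatMeasurable W)
    (hpos : ∀ᵐ x, (W x).PosDef) (hap : apNorm p W < ⊤) (I : DCube d)
    {φ : EuclideanSpace ℂ (Fin n)}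
    (hφ : ∀ v, ‖inner ℂ φ v‖ ≤ dualSeminorm hp hW hpos hap I v) :
    redAvgD p W I φ ≤ apNorm p W ^ (1 / p) := by
  have hp0 : 0 < p := by linarith
  have hp1 : 0 < p - 1 := by linarith
  have hq : 0 < p / (p - 1) := by positivity
  refine ENNReal.rpow_le_rpow (le_trans ?_ (lintegral_innerAvg_le_apNorm hp I)) (by positivity)
  refine mul_le_mul_right (lintegral_mono_ae (ae_restrict_of_ae ?_)) _
  filter_upwards [hpos] with x hx
  have hle : ENNReal.ofReal ‖mApp (W x) φ‖ ≤
      innerAvg (p / (p - 1)) W I x ^ (1 / (p / (p - 1))) := by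
    rcases eq_or_ne (ENNReal.ofReal ‖mApp (W x) φ‖) 0 with h0 | h0
    · simp [h0]
    refine (ENNReal.mul_le_mul_iff_left h0 ENNReal.ofReal_ne_top).1 ?_
    refine le_trans ?_ (redAvgD_inv_mApp_le hq hpos I hx (mApp (W x) φ))
    rw [← ofReal_dualSeminorm hp hW hpos hap, ← ENNReal.ofReal_mul (norm_nonneg _)]
    refine ENNReal.ofReal_le_ofReal (le_trans (le_of_eq ?_) (hφ _))
    rw [← inner_mApp_left hx.isHermitian, inner_self_eq_norm_sq_to_K, norm_pow, sq]
    simp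
  refine (ENNReal.rpow_le_rpow hle hp0.le).trans_eq ?_
  rw [← ENNReal.rpow_mul]
  congr 1
  field_simp

lemma IsReducing.redAvgD_inv_le (hp : 1 < p) (hW : MatMeasurable W)
    (hpos : ∀ᵐ x, (W x).PosDef) (hap : apNorm p W < ⊤) (hV : IsReducing p c₁ c₂ W V)
    (I : DCube d) (e : EuclideanSpace ℂ (Fin n)) :
    redAvgD (p / (p - 1)) (fun t => (W t)⁻¹) I (mApp (V I) e) ≤
      ENNReal.ofReal c₂ * apNorm p W ^ (1 / p) * ENNReal.ofReal ‖e‖ := by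
  obtain ⟨hVpos, hVI⟩ := hV I
  obtain ⟨φ, hφ, hle⟩ := (dualSeminorm hp hW hpos hap I).exists_inner_eq (mApp (V I) e)
  have hN : dualSeminorm hp hW hpos hap I (mApp (V I) e) ≤ ‖mApp (V I) φ‖ * ‖e‖ := by
    rw [← inner_mApp_left hVpos.isHermitian] at hφ
    calc dualSeminorm hp hW hpos hap I (mApp (V I) e) = ‖inner ℂ (mApp (V I) φ) e‖ := by
          rw [hφ]
          simp [abs_of_nonneg]
      _ ≤ _ := norm_inner_le_norm _ _
  rw [← ofReal_dualSeminorm hp hW hpos hap]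
  refine (ENNReal.ofReal_le_ofReal hN).trans ?_
  rw [ENNReal.ofReal_mul (norm_nonneg _)]
  gcongr
  refine (hVI φ).2.trans ?_
  gcongr
  exact redAvgD_le_apNorm_rpow hp hW hpos hap I hle

lemma ofReal_rpow_matNorm_le_sum (hq : 1 ≤ q) (M : Matrix (Fin n) (Fin n) ℂ) :
    ENNReal.ofReal (matNorm M ^ q) ≤ (n : ℝ≥0∞) ^ (q - 1) *
      ∑ j, ENNReal.ofReal ‖mApp M (EuclideanSpace.single j 1)‖ ^ q := by
  have h := ENNReal.rpow_sum_le_const_mul_sum_rpow Finset.univ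
    (fun j => ENNReal.ofReal ‖mApp M (EuclideanSpace.single j 1)‖) hq
  rw [Finset.card_univ, Fintype.card_fin] at h
  refine le_trans ?_ h
  rw [← ENNReal.ofReal_rpow_of_nonneg (matNorm_nonneg _) (by linarith),
    ← ENNReal.ofReal_sum_of_nonneg fun _ _ => norm_nonneg _]
  exact ENNReal.rpow_le_rpow (ENNReal.ofReal_le_ofReal (matNorm_le_sum M)) (by linarith)

lemma IsReducing.ofReal_vol_mul_le_sum_lintegral (hpq : p.HolderConjugate q)
    (hW : MatMeasurable W) (hpos : ∀ᵐ x, (W x).PosDef) (hV : IsReducing p c₁ c₂ W V)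
    (J : DCube d) (M : Matrix (Fin n) (Fin n) ℂ) {l : ℝ} (hl : l ≤ matNorm ((V J)⁻¹ * M) ^ q) :
    ENNReal.ofReal J.vol * (ENNReal.ofReal l * ENNReal.ofReal c₁ ^ q) ≤
      (n : ℝ≥0∞) ^ (q - 1) * ∑ j, ∫⁻ x in J.set,
        ENNReal.ofReal ‖mApp (W x)⁻¹ (mApp M (EuclideanSpace.single j 1))‖ ^ q := by
  have hq := hpq.symm.pos
  calc ENNReal.ofReal J.vol * (ENNReal.ofReal l * ENNReal.ofReal c₁ ^ q)
      ≤ ENNReal.ofReal J.vol * ((n : ℝ≥0∞) ^ (q - 1) *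
          (∑ j, ENNReal.ofReal ‖mApp ((V J)⁻¹ * M) (EuclideanSpace.single j 1)‖ ^ q) *
            ENNReal.ofReal c₁ ^ q) := by
        gcongr
        exact (ENNReal.ofReal_le_ofReal hl).trans (ofReal_rpow_matNorm_le_sum hpq.symm.lt.le _)
    _ = (n : ℝ≥0∞) ^ (q - 1) * ∑ j, ENNReal.ofReal J.vol * (ENNReal.ofReal c₁ *
          ENNReal.ofReal ‖mApp ((V J)⁻¹ * M) (EuclideanSpace.single j 1)‖) ^ q := by
        simp only [ENNReal.mul_rpow_of_nonneg _ _ hq.le, ← Finset.mul_sum]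
        ring
    _ ≤ _ := by
        gcongr with j
        rw [← ofReal_vol_mul_redAvgD_rpow (A := fun x => (W x)⁻¹) hq, mApp_mul]
        gcongr
        exact hV.ofReal_norm_inv_le_redAvgD hpq hW hpos J _

lemma IsReducing.lintegral_inv_le (hp : 1 < p) (hW : MatMeasurable W)
    (hpos : ∀ᵐ x, (W x).PosDef) (hap : apNorm p W < ⊤) (hV : IsReducing p c₁ c₂ W V)
    (I : DCube d) {e : EuclideanSpace ℂ (Fin n)} (he : ‖e‖ = 1) :
    ∫⁻ x in I.set, ENNReal.ofReal ‖mApp (W x)⁻¹ (mApp (V I) e)‖ ^ (p / (p - 1)) ≤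
      ENNReal.ofReal I.vol *
        (ENNReal.ofReal c₂ ^ (p / (p - 1)) * apNorm p W ^ (1 / (p - 1))) := by
  have hp0 : 0 < p := by linarith
  have hp1 : 0 < p - 1 := by linarith
  have hq : 0 < p / (p - 1) := by positivity
  rw [← ofReal_vol_mul_redAvgD_rpow (A := fun x => (W x)⁻¹) hq]
  refine mul_le_mul_right ((ENNReal.rpow_le_rpow
    (hV.redAvgD_inv_le hp hW hpos hap I e) hq.le).trans_eq ?_) _
  rw [he, ENNReal.ofReal_one, mul_one, ENNReal.mul_rpow_of_nonneg _ _ hq.le, ← ENNReal.rpow_mul]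
  congr 2
  field_simp

/-- The packing estimate for a disjoint family of subcubes `J` of `I` on which
`‖V_J⁻¹ V_I‖^{p'} ≥ l`. -/
lemma IsReducing.tsum_ofReal_vol_mul_le (hp : 1 < p) (hW : MatMeasurable W)
    (hpos : ∀ᵐ x, (W x).PosDef) (hap : apNorm p W < ⊤) (hV : IsReducing p c₁ c₂ W V)
    (I : DCube d) {l : ℝ} {S : Set (DCube d)} (hsub : ∀ J ∈ S, J.set ⊆ I.set)
    (hl : ∀ J ∈ S, l ≤ matNorm ((V J)⁻¹ * V I) ^ (p / (p - 1)))
    (hdisj : Pairwise fun J K : S => Disjoint (J : DCube d).set (K : DCube d).set) :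
    (∑' J : S, ENNReal.ofReal (J : DCube d).vol) *
        (ENNReal.ofReal l * ENNReal.ofReal c₁ ^ (p / (p - 1))) ≤
      (n : ℝ≥0∞) ^ (p / (p - 1) - 1) * (n * (ENNReal.ofReal I.vol *
        (ENNReal.ofReal c₂ ^ (p / (p - 1)) * apNorm p W ^ (1 / (p - 1))))) := by
  have hpq : p.HolderConjugate (p / (p - 1)) := .conjExponent hp
  rw [← ENNReal.tsum_mul_right]
  refine (ENNReal.tsum_le_tsum fun J : S => hV.ofReal_vol_mul_le_sum_lintegral hpq hW hpos J
    (V I) (hl J J.2)).trans ?_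
  rw [ENNReal.tsum_mul_left]
  gcongr
  rw [Summable.tsum_finsetSum fun _ _ => ENNReal.summable]
  refine (Finset.sum_le_card_nsmul _ _ _ fun j _ => ?_).trans_eq (by
    rw [Finset.card_univ, Fintype.card_fin, nsmul_eq_mul])
  rw [← lintegral_iUnion (fun J : S => (J : DCube d).measurableSet_set) hdisj]
  exact (lintegral_mono_set (Set.iUnion_subset fun J : S => hsub J J.2)).trans
    (hV.lintegral_inv_le hp hW hpos hap I (by simp))

end Weights

/-- Let `1 < p < ∞`, let `W` be a matrix `A_p` weight on `ℝ^d` with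
reducing operators `V_I`, let `I ∈ 𝒟`, let `λ₂ > 1`, and let `𝒢̃(I)` be the collection of
maximal dyadic subcubes `J ⊆ I` with `‖V_J^{-1} V_I‖^{p'} > λ₂`.  Then
`∑_{J ∈ 𝒢̃(I)} |J| ≤ (C₂ ‖W‖_{A_p}^{p'/p} / λ₂) |I|`, where `C₂` depends only on `n, d, p`
(and the comparability constants `c₁, c₂`), and `p' = p/(p-1)` (so `p'/p = 1/(p-1)`). -/
theorem statement7 (d n : ℕ) (hd : 0 < d) (hn : 0 < n) (p c₁ c₂ : ℝ)
    (hp : 1 < p) (hc₁ : 0 < c₁) (hc₂ : 0 < c₂) :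
    ∃ C₂ : ℝ, 0 < C₂ ∧
      ∀ (W1p : (Fin d → ℝ) → Matrix (Fin n) (Fin n) ℂ)
        (V : DCube d → Matrix (Fin n) (Fin n) ℂ) (I : DCube d) (l₂ : ℝ),
        MatMeasurable W1p →
        (∀ᵐ x ∂(volume : Measure (Fin d → ℝ)), (W1p x).PosDef) →
        apNorm p W1p < ⊤ →
        IsReducing p c₁ c₂ W1p V →
        1 < l₂ →
        ∑' J : {J : DCube d | J.set ⊆ I.set ∧
              l₂ < matNorm ((V J)⁻¹ * V I) ^ (p / (p - 1)) ∧
              ∀ K : DCube d, K.set ⊆ I.set →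
                l₂ < matNorm ((V K)⁻¹ * V I) ^ (p / (p - 1)) → J.set ⊆ K.set → K = J},
            ENNReal.ofReal (J : DCube d).vol ≤
          ENNReal.ofReal (C₂ * (apNorm p W1p).toReal ^ (1 / (p - 1)) / l₂) *
            ENNReal.ofReal I.vol := by
  have hp1 : 0 < p - 1 := by linarith
  set q := p / (p - 1) with hq
  refine ⟨(n : ℝ) ^ (q - 1) * n * c₂ ^ q / c₁ ^ q, by positivity, ?_⟩
  intro W V I l₂ hW hpos hap hV hl₂
  have hl0 : 0 < l₂ := by linarith
  have hq0 : 0 < q := div_pos (by linarith) hp1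
  set S : Set (DCube d) := {J : DCube d | J.set ⊆ I.set ∧ l₂ < matNorm ((V J)⁻¹ * V I) ^ q ∧
    ∀ K : DCube d, K.set ⊆ I.set → l₂ < matNorm ((V K)⁻¹ * V I) ^ q → J.set ⊆ K.set → K = J}
  have hdisj : Pairwise fun J K : S => Disjoint (J : DCube d).set (K : DCube d).set :=
    DCube.pairwise_disjoint_of_maximal
      (P := fun J => J.set ⊆ I.set ∧ l₂ < matNorm ((V J)⁻¹ * V I) ^ q)
      fun J hJ => ⟨⟨hJ.1, hJ.2.1⟩, fun K hK => hJ.2.2 K hK.1 hK.2⟩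
  have h := hV.tsum_ofReal_vol_mul_le hp hW hpos hap I (fun J hJ => hJ.1)
    (fun J (hJ : J ∈ S) => hJ.2.1.le) hdisj
  rw [← hq, ENNReal.ofReal_rpow_of_nonneg hc₁.le hq0.le,
    ENNReal.ofReal_rpow_of_nonneg hc₂.le hq0.le,
    ← ENNReal.ofReal_mul hl0.le, ← ENNReal.ofReal_toReal hap.ne,
    ENNReal.ofReal_rpow_of_nonneg ENNReal.toReal_nonneg (by positivity),
    ← ENNReal.ofReal_natCast, ENNReal.ofReal_rpow_of_pos (by positivity)] at h
  have hpos' : 0 < l₂ * c₁ ^ q := by positivity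
  have hvol := I.vol_pos.le
  rw [← ENNReal.le_div_iff_mul_le (by simp [hpos']) (by simp)] at h
  refine h.trans_eq ?_
  rw [← ENNReal.ofReal_mul (by positivity), ← ENNReal.ofReal_mul hvol,
    ← ENNReal.ofReal_mul (by positivity), ← ENNReal.ofReal_mul (by positivity),
    ← ENNReal.ofReal_div_of_pos hpos', ← ENNReal.ofReal_mul (by positivity)]
  congr 1
  field_simp

end
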